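/- Let s, t ≥ 2 be integers. The palette index of the Cartesian product P_s □ P_t equals: 1 if s = t = 2; 2 if min(s,t) = 2 and max(s,t) ≥ 3; 3 if s, t ≥ 3 and s·t is even; and 5 if s, t ≥ 3 and s·t is odd. -/

import Mathlib

open SimpleGraph

/-- A proper edge coloring of `G` (colors in `ℕ`): distinct edges sharing a
vertex receive different colors. -/
def IsProperEdgeColoring {V : Type*} (G : SimpleGraph V) (f : Sym2 V → ℕ) : Prop :=
  ∀ e₁ ∈ G.edgeSet, ∀ e₂ ∈ G.edgeSet, e₁ ≠ e₂ → (∃ v, v ∈ e₁ ∧ v ∈ e₂) → f e₁ ≠ f e₂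

/-- The palette of a vertex `v` under an edge coloring `f`: the set of colors
assigned to the edges incident to `v`. -/
def palette {V : Type*} (G : SimpleGraph V) (f : Sym2 V → ℕ) (v : V) : Set ℕ :=
  {c | ∃ e ∈ G.edgeSet, v ∈ e ∧ f e = c}

/-- The number of distinct palettes of vertices of `G` with respect to `f`. -/
noncomputable def numPalettes {V : Type*} (G : SimpleGraph V) (f : Sym2 V → ℕ) : ℕ :=
  (Set.range (palette G f)).ncard

/-- The palette index `š(G)`: the minimum number of distinct vertex palettes
over all proper edge colorings of `G`. -/
noncomputable def paletteIndex {V : Type*} (G : SimpleGraph V) : ℕ :=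
  sInf {n | ∃ f, IsProperEdgeColoring G f ∧ numPalettes G f = n}

/-- The chromatic index `χ'(G)`: the minimum `n` such that `G` has a proper
edge coloring with colors from `{0, …, n-1}`. -/
noncomputable def chromIndex {V : Type*} (G : SimpleGraph V) : ℕ :=
  sInf {n | ∃ f, IsProperEdgeColoring G f ∧ ∀ e ∈ G.edgeSet, f e < n}

/-- The degree of a vertex. -/
noncomputable def vertDegree {V : Type*} (G : SimpleGraph V) (v : V) : ℕ :=
  (G.neighborSet v).ncard

/-- The maximum degree `Δ(G)`. -/
noncomputable def maxDeg {V : Type*} (G : SimpleGraph V) : ℕ :=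
  sSup (Set.range (vertDegree G))

/-- `G` is class 1 if `χ'(G) = Δ(G)`. -/
def IsClass1 {V : Type*} (G : SimpleGraph V) : Prop := chromIndex G = maxDeg G

/-- `G` is `r`-regular. -/
def IsRegularDeg {V : Type*} (G : SimpleGraph V) (r : ℕ) : Prop :=
  ∀ v, vertDegree G v = r

/-- A perfect matching: a set `M` of edges of `G` such that every vertex is
incident to exactly one edge of `M`. -/
def IsPerfectMatchingSet {V : Type*} (G : SimpleGraph V) (M : Set (Sym2 V)) : Prop :=
  M ⊆ G.edgeSet ∧ ∀ v : V, ∃! e, e ∈ M ∧ v ∈ e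


/-! Lower-bound combinatorics on palettes, in terms of weights. -/

section weights
open Classical

/-- Weight of a palette in a color class equation. -/
noncomputable def iw (P : Set ℕ) (c : ℕ) (a : ℤ) : ℤ := if c ∈ P then a else 0

lemma exists_not_mem_of_ncard {A B : Set ℕ} (hB : B.ncard ≠ 0) (h : B.ncard < A.ncard) :
    ∃ c ∈ A, c ∉ B := by
  by_contra! hc
  exact absurd (Set.ncard_le_ncard hc (Set.finite_of_ncard_ne_zero hB)) (by omega)

lemma weights4 {A1 A2 B C : Set ℕ} {a1 a2 : ℤ} (h1 : A1.ncard = 4) (h2 : A2.ncard = 4)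
    (ha : a1 + a2 = 1)
    (h : ∀ c, iw A1 c a1 + iw A2 c a2 + iw B c (-4) + iw C c 4 = 0) : False := by
  obtain ⟨x, hx⟩ : A1.Nonempty := Set.nonempty_of_ncard_ne_zero (by omega)
  obtain ⟨y, hy⟩ : A2.Nonempty := Set.nonempty_of_ncard_ne_zero (by omega)
  have hx' := h x
  have hy' := h y
  simp only [iw, hx, hy, if_true] at hx' hy'
  split_ifs at hx' hy' <;> omega

lemma weights3 {A B1 B2 C : Set ℕ} {b1 b2 : ℤ} (hA : A.ncard = 4) (h1 : B1.ncard = 3)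
    (h2 : B2.ncard = 3) (hb : b1 + b2 = -4)
    (h : ∀ c, iw A c 1 + iw B1 c b1 + iw B2 c b2 + iw C c 4 = 0) : False := by
  obtain ⟨x, hx, hxB⟩ := exists_not_mem_of_ncard (A := A) (B := B1) (by omega) (by omega)
  obtain ⟨y, hy, hyB⟩ := exists_not_mem_of_ncard (A := A) (B := B2) (by omega) (by omega)
  have hx' := h x
  have hy' := h y
  simp only [iw, hx, hy, hxB, hyB, if_true, if_false] at hx' hy'
  split_ifs at hx' hy' <;> omega

lemma weights2 {A B C1 C2 : Set ℕ} {c1 c2 : ℤ} (hA : A.ncard = 4) (h1 : B.ncard = 3)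
    (hc1 : 0 ≤ c1) (hc2 : 0 ≤ c2)
    (h : ∀ c, iw A c 1 + iw B c (-4) + iw C1 c c1 + iw C2 c c2 = 0) : False := by
  obtain ⟨x, hx, hxB⟩ := exists_not_mem_of_ncard (A := A) (B := B) (by omega) (by omega)
  have hx' := h x
  simp only [iw, hx, hxB, if_true, if_false] at hx'
  split_ifs at hx' <;> omega

/-- Abstract version of the lower bound: a finite set of palettes with weights. -/
lemma five_le_card (S : Finset (Set ℕ)) (w : Set ℕ → ℤ)
    (hS : ∀ P ∈ S, P.ncard = 2 ∨ P.ncard = 3 ∨ P.ncard = 4)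
    (h2 : ∑ P ∈ S with P.ncard = 2, w P = 4)
    (h3 : ∑ P ∈ S with P.ncard = 3, w P = -4)
    (h4 : ∑ P ∈ S with P.ncard = 4, w P = 1)
    (hw : ∀ P ∈ S, P.ncard = 2 → 0 ≤ w P)
    (hc : ∀ c, ∑ P ∈ S, iw P c (w P) = 0) : 5 ≤ S.card := by
  by_contra! hlt
  have split : ∀ g : Set ℕ → ℤ, ∑ P ∈ S, g P = ∑ P ∈ S with P.ncard = 2, g P +
      ∑ P ∈ S with P.ncard = 3, g P + ∑ P ∈ S with P.ncard = 4, g P := by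
    intro g
    simp only [Finset.sum_filter, ← Finset.sum_add_distrib]
    refine Finset.sum_congr rfl fun P hP => ?_
    rcases hS P hP with h | h | h <;> simp [h]
  have hcard : S.card = (S.filter fun P => P.ncard = 2).card +
      (S.filter fun P => P.ncard = 3).card + (S.filter fun P => P.ncard = 4).card := by
    have := split 1
    simp only [Pi.one_apply, Finset.sum_const, nsmul_eq_mul, mul_one] at this
    exact_mod_cast this
  have hc' : ∀ c, _ := fun c => (split fun P => iw P c (w P)).symm.trans (hc c)
  have key : ∀ (k : ℕ) (z : ℤ), z ≠ 0 → ∑ P ∈ S with P.ncard = k, w P = z →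
      (S.filter fun P => P.ncard = k).card ≠ 0 := by
    intro k z hz h h0
    rw [Finset.card_eq_zero] at h0
    rw [h0] at h
    exact hz (by simpa using h.symm)
  have k2 := key 2 _ (by norm_num) h2
  have k3 := key 3 _ (by norm_num) h3
  have k4 := key 4 _ (by norm_num) h4
  have one : ∀ k, (S.filter fun P => P.ncard = k).card = 1 →
      ∃ P ∈ S, P.ncard = k ∧ ∀ g : Set ℕ → ℤ, ∑ P ∈ S with P.ncard = k, g P = g P := by
    intro k hk
    obtain ⟨P, hP⟩ := Finset.card_eq_one.1 hk
    have : P ∈ S.filter fun P => P.ncard = k := by simp [hP]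
    rw [Finset.mem_filter] at this
    exact ⟨P, this.1, this.2, fun g => by simp [hP]⟩
  have two : ∀ k, (S.filter fun P => P.ncard = k).card = 2 →
      ∃ P ∈ S, ∃ Q ∈ S, P.ncard = k ∧ Q.ncard = k ∧
        ∀ g : Set ℕ → ℤ, ∑ P ∈ S with P.ncard = k, g P = g P + g Q := by
    intro k hk
    obtain ⟨P, Q, hne, hP⟩ := Finset.card_eq_two.1 hk
    have h1 : P ∈ S.filter fun P => P.ncard = k := by simp [hP]
    have h2 : Q ∈ S.filter fun P => P.ncard = k := by simp [hP]
    rw [Finset.mem_filter] at h1 h2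
    exact ⟨P, h1.1, Q, h2.1, h1.2, h2.2, fun g => by rw [hP, Finset.sum_pair hne]⟩
  have cases4 : ((S.filter fun P => P.ncard = 2).card = 1 ∧
      (S.filter fun P => P.ncard = 3).card = 1 ∧ (S.filter fun P => P.ncard = 4).card = 1) ∨
      ((S.filter fun P => P.ncard = 2).card = 2 ∧
      (S.filter fun P => P.ncard = 3).card = 1 ∧ (S.filter fun P => P.ncard = 4).card = 1) ∨
      ((S.filter fun P => P.ncard = 2).card = 1 ∧
      (S.filter fun P => P.ncard = 3).card = 2 ∧ (S.filter fun P => P.ncard = 4).card = 1) ∨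
      ((S.filter fun P => P.ncard = 2).card = 1 ∧
      (S.filter fun P => P.ncard = 3).card = 1 ∧ (S.filter fun P => P.ncard = 4).card = 2) := by
    omega
  rcases cases4 with ⟨e2, e3, e4⟩ | ⟨e2, e3, e4⟩ | ⟨e2, e3, e4⟩ | ⟨e2, e3, e4⟩
  · obtain ⟨C, hC, nC, sC⟩ := one 2 e2
    obtain ⟨B, hB, nB, sB⟩ := one 3 e3
    obtain ⟨A, hA, nA, sA⟩ := one 4 e4
    simp only [sA, sB, sC] at h2 h3 h4 hc'
    refine weights2 (A := A) (B := B) (C1 := C) (C2 := C) (c1 := 4) (c2 := 0) nA nB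
      (by norm_num) le_rfl fun c => ?_
    have := hc' c
    rw [h2, h3, h4] at this
    have h0 : iw C c 0 = 0 := by simp [iw]
    linarith
  · obtain ⟨C, hC, C', hC', nC, nC', sC⟩ := two 2 e2
    obtain ⟨B, hB, nB, sB⟩ := one 3 e3
    obtain ⟨A, hA, nA, sA⟩ := one 4 e4
    simp only [sA, sB, sC] at h2 h3 h4 hc'
    refine weights2 (A := A) (B := B) (C1 := C) (C2 := C') nA nB
      (hw _ hC nC) (hw _ hC' nC') fun c => ?_
    have := hc' c
    rw [h3, h4] at this
    linarith
  · obtain ⟨C, hC, nC, sC⟩ := one 2 e2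
    obtain ⟨B, hB, B', hB', nB, nB', sB⟩ := two 3 e3
    obtain ⟨A, hA, nA, sA⟩ := one 4 e4
    simp only [sA, sB, sC] at h2 h3 h4 hc'
    refine weights3 (A := A) (B1 := B) (B2 := B') (C := C) nA nB nB' h3 fun c => ?_
    have := hc' c
    rw [h2, h4] at this
    linarith
  · obtain ⟨C, hC, nC, sC⟩ := one 2 e2
    obtain ⟨B, hB, nB, sB⟩ := one 3 e3
    obtain ⟨A, hA, A', hA', nA, nA', sA⟩ := two 4 e4
    simp only [sA, sB, sC] at h2 h3 h4 hc'
    refine weights4 (A1 := A) (A2 := A') (B := B) (C := C) nA nA' h4 fun c => ?_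
    have := hc' c
    rw [h2, h3] at this
    linarith

end weights

/-! The grid graph: degrees and palette sizes. -/

/-- Degree in the path with `n` vertices. -/
def pdeg (n i : ℕ) : ℕ := if i = 0 ∨ i + 1 = n then 1 else 2

lemma pathGraph_ncard (n : ℕ) (hn : 2 ≤ n) (i : Fin n) :
    ((pathGraph n).neighborSet i).ncard = pdeg n i := by
  obtain ⟨i, hi⟩ := i
  unfold pdeg
  by_cases h0 : i = 0
  · have : (pathGraph n).neighborSet ⟨i, hi⟩ = {⟨1, by omega⟩} := by
      ext ⟨x, hx⟩
      simp [pathGraph_adj]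
      omega
    rw [this]; simp [h0]
  · by_cases h1 : i + 1 = n
    · have : (pathGraph n).neighborSet ⟨i, hi⟩ = {⟨i - 1, by omega⟩} := by
        ext ⟨x, hx⟩
        simp [pathGraph_adj]
        omega
      rw [this]; simp [h1]
    · have : (pathGraph n).neighborSet ⟨i, hi⟩ = {⟨i - 1, by omega⟩, ⟨i + 1, by omega⟩} := by
        ext ⟨x, hx⟩
        simp [pathGraph_adj]
        omega
      rw [this, Set.ncard_pair (by simp)]; simp [h0, h1]

lemma grid_ncard (s t : ℕ) (hs : 2 ≤ s) (ht : 2 ≤ t) (v : Fin s × Fin t) :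
    ((pathGraph s □ pathGraph t).neighborSet v).ncard = pdeg s v.1 + pdeg t v.2 := by
  classical
  have h := degree_boxProd (G := pathGraph s) (H := pathGraph t) v
  rw [← card_neighborSet_eq_degree, ← card_neighborSet_eq_degree,
    ← card_neighborSet_eq_degree, ← Nat.card_eq_fintype_card, ← Nat.card_eq_fintype_card,
    ← Nat.card_eq_fintype_card, Nat.card_coe_set_eq, Nat.card_coe_set_eq, Nat.card_coe_set_eq,
    pathGraph_ncard _ hs, pathGraph_ncard _ ht] at h
  exact h

lemma palette_eq_image {V : Type*} (G : SimpleGraph V) (f : Sym2 V → ℕ) (v : V) :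
    palette G f v = (fun x => f s(v, x)) '' G.neighborSet v := by
  ext c
  constructor
  · rintro ⟨e, he, hv, rfl⟩
    obtain ⟨x, rfl⟩ := hv
    exact ⟨x, he, rfl⟩
  · rintro ⟨x, hx, rfl⟩
    exact ⟨s(v, x), hx, by simp, rfl⟩

lemma proper_inj {V : Type*} {G : SimpleGraph V} {f : Sym2 V → ℕ}
    (hf : IsProperEdgeColoring G f) {v x y : V} (hx : G.Adj v x) (hy : G.Adj v y)
    (h : f s(v, x) = f s(v, y)) : x = y := by
  by_contra hne
  refine hf s(v, x) hx s(v, y) hy ?_ ⟨v, by simp, by simp⟩ h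
  intro h'
  exact hne (Sym2.congr_right.1 h')

lemma palette_ncard {s t : ℕ} (hs : 2 ≤ s) (ht : 2 ≤ t) {f : Sym2 (Fin s × Fin t) → ℕ}
    (hf : IsProperEdgeColoring (pathGraph s □ pathGraph t) f) (v : Fin s × Fin t) :
    (palette (pathGraph s □ pathGraph t) f v).ncard = pdeg s v.1 + pdeg t v.2 := by
  rw [palette_eq_image, Set.InjOn.ncard_image, grid_ncard s t hs ht]
  intro x hx y hy h
  exact proper_inj hf hx hy h

/-- Checkerboard sign. -/
def sgn {s t : ℕ} (v : Fin s × Fin t) : ℤ := (-1) ^ ((v.1 : ℕ) + v.2)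

lemma sgn_adj {s t : ℕ} {v x : Fin s × Fin t} (h : (pathGraph s □ pathGraph t).Adj v x) :
    sgn v + sgn x = 0 := by
  obtain ⟨⟨i, hi⟩, ⟨j, hj⟩⟩ := v
  obtain ⟨⟨k, hk⟩, ⟨l, hl⟩⟩ := x
  simp only [boxProd_adj, pathGraph_adj, Fin.mk.injEq, sgn] at *
  rcases h with ⟨h | h, h'⟩ | ⟨h | h, h'⟩ <;> subst h <;> subst h' <;> ring

open Classical in
lemma sum_color {s t : ℕ} {f : Sym2 (Fin s × Fin t) → ℕ}
    (hf : IsProperEdgeColoring (pathGraph s □ pathGraph t) f) (c : ℕ) :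
    ∑ v with c ∈ palette (pathGraph s □ pathGraph t) f v, sgn v = 0 := by
  have hex : ∀ v : Fin s × Fin t, c ∈ palette (pathGraph s □ pathGraph t) f v →
      ∃ x, (pathGraph s □ pathGraph t).Adj v x ∧ f s(v, x) = c := by
    intro v hv
    rw [palette_eq_image] at hv
    exact hv
  choose! g hg using hex
  have hmem : ∀ v : Fin s × Fin t, c ∈ palette (pathGraph s □ pathGraph t) f v →
      c ∈ palette (pathGraph s □ pathGraph t) f (g v) := fun v hv =>
    ⟨s(v, g v), (hg v hv).1, by simp, (hg v hv).2⟩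
  refine Finset.sum_involution (fun v _ => g v) ?_ ?_ ?_ ?_
  · intro v hv
    exact sgn_adj (hg v (by simpa using hv)).1
  · intro v hv _
    exact (hg v (by simpa using hv)).1.ne'
  · intro v hv
    simpa using hmem v (by simpa using hv)
  · intro v hv
    have hv' : c ∈ palette (pathGraph s □ pathGraph t) f v := by simpa using hv
    have h1 := hg v hv'
    have h2 := hg (g v) (hmem v hv')
    refine proper_inj hf h2.1 h1.1.symm ?_
    rw [h2.2, Sym2.eq_swap, h1.2]

lemma sum_end (m : ℕ) (hm : Odd m) :
    ∑ i : Fin (m + 2), (if pdeg (m + 2) i = 1 then (-1 : ℤ) ^ (i : ℕ) else 0) = 2 := by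
  rw [Fin.sum_univ_eq_sum_range (fun i => if pdeg (m + 2) i = 1 then (-1 : ℤ) ^ i else 0),
    Finset.sum_range_succ, Finset.sum_range_succ', Finset.sum_eq_zero]
  · have : Even (m + 1) := hm.add_one
    simp [pdeg, this.neg_one_pow]
  · intro x hx
    have := Finset.mem_range.1 hx
    simp [pdeg, this.ne]

lemma sum_mid (m : ℕ) (hm : Odd m) :
    ∑ i : Fin (m + 2), (if pdeg (m + 2) i = 2 then (-1 : ℤ) ^ (i : ℕ) else 0) = -1 := by
  rw [Fin.sum_univ_eq_sum_range (fun i => if pdeg (m + 2) i = 2 then (-1 : ℤ) ^ i else 0),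
    Finset.sum_range_succ, Finset.sum_range_succ']
  have : ∑ k ∈ Finset.range m, (if pdeg (m + 2) (k + 1) = 2 then (-1 : ℤ) ^ (k + 1) else 0)
      = - ∑ k ∈ Finset.range m, (-1 : ℤ) ^ k := by
    rw [← Finset.sum_neg_distrib]
    refine Finset.sum_congr rfl fun x hx => ?_
    have := Finset.mem_range.1 hx
    simp [pdeg, this.ne, pow_succ]
  rw [this, neg_one_geom_sum]
  simp [pdeg, hm]

lemma pdeg_cases (n i : ℕ) : pdeg n i = 1 ∨ pdeg n i = 2 := by
  unfold pdeg; split_ifs <;> simp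

lemma sum_deg (s t : ℕ) (hs : 3 ≤ s) (ht : 3 ≤ t) (os : Odd s) (ot : Odd t) :
    (∑ v : Fin s × Fin t, (if pdeg s v.1 + pdeg t v.2 = 2 then sgn v else 0) = 4) ∧
    (∑ v : Fin s × Fin t, (if pdeg s v.1 + pdeg t v.2 = 3 then sgn v else 0) = -4) ∧
    (∑ v : Fin s × Fin t, (if pdeg s v.1 + pdeg t v.2 = 4 then sgn v else 0) = 1) := by
  obtain ⟨m, rfl⟩ := Nat.exists_eq_add_of_le' (show 2 ≤ s by omega)
  obtain ⟨n, rfl⟩ := Nat.exists_eq_add_of_le' (show 2 ≤ t by omega)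
  have om : Odd m := by grind
  have on : Odd n := by grind
  have pr : ∀ a b : ℕ, ∑ v : Fin (m+2) × Fin (n+2),
      (if pdeg (m+2) v.1 = a then (-1 : ℤ) ^ (v.1 : ℕ) else 0) *
      (if pdeg (n+2) v.2 = b then (-1 : ℤ) ^ (v.2 : ℕ) else 0) =
      (∑ i : Fin (m + 2), (if pdeg (m + 2) i = a then (-1 : ℤ) ^ (i : ℕ) else 0)) *
      (∑ i : Fin (n + 2), (if pdeg (n + 2) i = b then (-1 : ℤ) ^ (i : ℕ) else 0)) := by
    intro a b
    rw [Finset.sum_mul_sum, ← Finset.univ_product_univ, Finset.sum_product]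
  have p11 := pr 1 1
  have p12 := pr 1 2
  have p21 := pr 2 1
  have p22 := pr 2 2
  rw [sum_end m om, sum_end n on] at p11
  rw [sum_end m om, sum_mid n on] at p12
  rw [sum_mid m om, sum_end n on] at p21
  rw [sum_mid m om, sum_mid n on] at p22
  refine ⟨?_, ?_, ?_⟩
  · refine Eq.trans (Finset.sum_congr rfl fun v _ => ?_) p11
    rcases pdeg_cases (m+2) v.1 with h | h <;> rcases pdeg_cases (n+2) v.2 with h' | h' <;>
      simp [h, h', sgn, pow_add]
  · have := congrArg₂ (· + ·) p12 p21
    simp only [← Finset.sum_add_distrib] at this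
    refine Eq.trans (Finset.sum_congr rfl fun v _ => ?_) this
    rcases pdeg_cases (m+2) v.1 with h | h <;> rcases pdeg_cases (n+2) v.2 with h' | h' <;>
      simp [h, h', sgn, pow_add]
  · refine Eq.trans (Finset.sum_congr rfl fun v _ => ?_) p22
    rcases pdeg_cases (m+2) v.1 with h | h <;> rcases pdeg_cases (n+2) v.2 with h' | h' <;>
      simp [h, h', sgn, pow_add]

lemma sgn_corner {s t : ℕ} (os : Odd s) (ot : Odd t) (v : Fin s × Fin t)
    (h : pdeg s v.1 + pdeg t v.2 = 2) : 0 ≤ sgn v := by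
  have : Even ((v.1 : ℕ) + v.2) := by
    unfold pdeg at h
    grind
  unfold sgn
  rw [this.neg_one_pow]
  norm_num

lemma lower_odd (s t : ℕ) (hs : 3 ≤ s) (ht : 3 ≤ t) (os : Odd s) (ot : Odd t)
    {f : Sym2 (Fin s × Fin t) → ℕ}
    (hf : IsProperEdgeColoring (pathGraph s □ pathGraph t) f) :
    5 ≤ numPalettes (pathGraph s □ pathGraph t) f := by
  classical
  set p := palette (pathGraph s □ pathGraph t) f with hp
  have hnc : ∀ v, (p v).ncard = pdeg s v.1 + pdeg t v.2 :=
    palette_ncard (by omega) (by omega) hf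
  have hS : numPalettes (pathGraph s □ pathGraph t) f = (Finset.univ.image p).card := by
    rw [numPalettes, ← Set.ncard_coe_finset]
    simp [hp]
  rw [hS]
  have fib : ∀ g : Set ℕ → ℤ → ℤ, (∀ P, g P 0 = 0) →
      (∀ P a b, g P (a + b) = g P a + g P b) →
      ∑ P ∈ Finset.univ.image p, g P (∑ v with p v = P, sgn v) = ∑ v, g (p v) (sgn v) := by
    intro g h0 hadd
    rw [← Finset.sum_fiberwise_of_maps_to (s := Finset.univ) (t := Finset.univ.image p) (g := p)
      (fun x _ => Finset.mem_image_of_mem _ (Finset.mem_univ _))]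
    refine Finset.sum_congr rfl fun P _ => ?_
    let G : ℤ →+ ℤ := ⟨⟨g P, h0 P⟩, hadd P⟩
    have := map_sum G sgn (Finset.univ.filter fun v => p v = P)
    refine Eq.trans this (Finset.sum_congr rfl fun v hv => ?_)
    rw [(Finset.mem_filter.1 hv).2]
    rfl
  have fk : ∀ k : ℕ, ∑ P ∈ Finset.univ.image p with P.ncard = k, (∑ v with p v = P, sgn v) =
      ∑ v : Fin s × Fin t, (if pdeg s v.1 + pdeg t v.2 = k then sgn v else 0) := by
    intro k
    rw [Finset.sum_filter]
    have := fib (fun P a => if P.ncard = k then a else 0) (by simp)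
      (by intro P a b; split_ifs <;> simp)
    simp only [hnc] at this
    exact this
  obtain ⟨d2, d3, d4⟩ := sum_deg s t hs ht os ot
  refine five_le_card _ (fun P => ∑ v with p v = P, sgn v) ?_ ((fk 2).trans d2)
    ((fk 3).trans d3) ((fk 4).trans d4) ?_ ?_
  · intro P hP
    obtain ⟨v, _, rfl⟩ := Finset.mem_image.1 hP
    rw [hnc]
    rcases pdeg_cases s v.1 with h | h <;> rcases pdeg_cases t v.2 with h' | h' <;> simp [h, h']
  · intro P _ h2
    refine Finset.sum_nonneg fun v hv => sgn_corner os ot v ?_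
    rw [← hnc, (Finset.mem_filter.1 hv).2, h2]
  · intro c
    refine (fib (fun P a => iw P c a) (by simp [iw])
      (by intro P a b; simp only [iw]; split_ifs <;> simp)).trans ?_
    simp only [iw]
    rw [← Finset.sum_filter]
    exact sum_color hf c

lemma pdeg_zero (n : ℕ) : pdeg n 0 = 1 := by simp [pdeg]
lemma pdeg_one (n : ℕ) (h : 3 ≤ n) : pdeg n 1 = 2 := by
  have : 1 + 1 ≠ n := by omega
  simp [pdeg, this]
lemma fill4 (a b c d e : ℕ) (ha : a < 4) (hb : b < 4) (hc : c < 4) (hd : d < 4) (he : e < 4)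
    (h1 : a ≠ b) (h2 : a ≠ c) (h3 : a ≠ d) (h4 : b ≠ c) (h5 : b ≠ d) (h6 : c ≠ d) :
    e = a ∨ e = b ∨ e = c ∨ e = d := by
  omega
lemma fill3 (x y z a b c e : ℕ) (ha : a = x ∨ a = y ∨ a = z) (hb : b = x ∨ b = y ∨ b = z)
    (hc : c = x ∨ c = y ∨ c = z) (he : e = x ∨ e = y ∨ e = z)
    (h1 : a ≠ b) (h2 : a ≠ c) (h4 : b ≠ c) :
    e = a ∨ e = b ∨ e = c := by
  grind
lemma fill2 (x y a b e : ℕ) (ha : a = x ∨ a = y) (hb : b = x ∨ b = y)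
    (he : e = x ∨ e = y) (h1 : a ≠ b) :
    e = a ∨ e = b := by
  grind

/-! Explicit colorings. -/

/-- The coloring of the grid with horizontal colors `H i j` (edge `(i,j)-(i,j+1)`) and vertical
colors `V i j` (edge `(i,j)-(i+1,j)`). -/
def gcol (s t : ℕ) (H V : ℕ → ℕ → ℕ) : Sym2 (Fin s × Fin t) → ℕ :=
  Sym2.lift ⟨fun p q => if (p.1 : ℕ) = q.1 then H (min (p.1 : ℕ) q.1) (min (p.2 : ℕ) q.2)
    else V (min (p.1 : ℕ) q.1) (min (p.2 : ℕ) q.2), by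
      intro p q
      simp only [min_comm (q.1 : ℕ), min_comm (q.2 : ℕ), eq_comm (a := (q.1 : ℕ))]⟩

/-- The color set seen at `(i, j)`. -/
def gpal (s t : ℕ) (H V : ℕ → ℕ → ℕ) (i j : ℕ) : Set ℕ :=
  {c | (j + 1 < t ∧ c = H i j) ∨ (0 < j ∧ c = H i (j - 1)) ∨
    (i + 1 < s ∧ c = V i j) ∨ (0 < i ∧ c = V (i - 1) j)}

/-- Local properness at `(i, j)`. -/
def gprop (s t : ℕ) (H V : ℕ → ℕ → ℕ) (i j : ℕ) : Prop :=
  (j + 1 < t → 0 < j → H i j ≠ H i (j - 1)) ∧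
  (j + 1 < t → i + 1 < s → H i j ≠ V i j) ∧
  (j + 1 < t → 0 < i → H i j ≠ V (i - 1) j) ∧
  (0 < j → i + 1 < s → H i (j - 1) ≠ V i j) ∧
  (0 < j → 0 < i → H i (j - 1) ≠ V (i - 1) j) ∧
  (i + 1 < s → 0 < i → V i j ≠ V (i - 1) j)

/-- The four kinds of neighbours of a grid vertex, with the color of the edge. -/
lemma gcol_adj {s t : ℕ} {H V : ℕ → ℕ → ℕ} {i j k l : ℕ} (hi : i < s) (hj : j < t)
    (hk : k < s) (hl : l < t)
    (h : (pathGraph s □ pathGraph t).Adj (⟨i, hi⟩, ⟨j, hj⟩) (⟨k, hk⟩, ⟨l, hl⟩)) :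
    (k = i ∧ l = j + 1 ∧ gcol s t H V s((⟨i, hi⟩, ⟨j, hj⟩), (⟨k, hk⟩, ⟨l, hl⟩)) = H i j) ∨
    (k = i ∧ 0 < j ∧ l = j - 1 ∧
      gcol s t H V s((⟨i, hi⟩, ⟨j, hj⟩), (⟨k, hk⟩, ⟨l, hl⟩)) = H i (j - 1)) ∨
    (k = i + 1 ∧ l = j ∧ gcol s t H V s((⟨i, hi⟩, ⟨j, hj⟩), (⟨k, hk⟩, ⟨l, hl⟩)) = V i j) ∨
    (0 < i ∧ k = i - 1 ∧ l = j ∧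
      gcol s t H V s((⟨i, hi⟩, ⟨j, hj⟩), (⟨k, hk⟩, ⟨l, hl⟩)) = V (i - 1) j) := by
  simp only [boxProd_adj, pathGraph_adj, Fin.mk.injEq] at h
  simp only [gcol, Sym2.lift_mk]
  rcases h with ⟨h | h, h'⟩ | ⟨h | h, h'⟩ <;> subst h <;> subst h' <;> simp

lemma gcol_proper {s t : ℕ} {H V : ℕ → ℕ → ℕ}
    (h : ∀ i j, i < s → j < t → gprop s t H V i j) :
    IsProperEdgeColoring (pathGraph s □ pathGraph t) (gcol s t H V) := by
  rintro e₁ h₁ e₂ h₂ hne ⟨v, hv₁, hv₂⟩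
  obtain ⟨x, rfl⟩ := hv₁
  obtain ⟨y, rfl⟩ := hv₂
  have hxy : x ≠ y := fun h => hne (by rw [h])
  obtain ⟨⟨i, hi⟩, ⟨j, hj⟩⟩ := v
  obtain ⟨⟨k, hk⟩, ⟨l, hl⟩⟩ := x
  obtain ⟨⟨m, hm⟩, ⟨n, hn⟩⟩ := y
  have a1 := gcol_adj (H := H) (V := V) hi hj hk hl h₁
  have a2 := gcol_adj (H := H) (V := V) hi hj hm hn h₂
  obtain ⟨q1, q2, q3, q4, q5, q6⟩ := h i j hi hj
  simp only [ne_eq, Prod.mk.injEq, Fin.mk.injEq] at hxy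
  rcases a1 with ⟨b1, b2, b3⟩ | ⟨b0, b1, b2, b3⟩ | ⟨b1, b2, b3⟩ | ⟨b0, b1, b2, b3⟩ <;>
  rcases a2 with ⟨c1, c2, c3⟩ | ⟨c0, c1, c2, c3⟩ | ⟨c1, c2, c3⟩ | ⟨c0, c1, c2, c3⟩ <;>
  rw [b3, c3] <;> clear b3 c3 <;> first
    | (exfalso; omega)
    | exact q1 (by omega) (by omega)
    | exact q2 (by omega) (by omega)
    | exact q3 (by omega) (by omega)
    | exact q4 (by omega) (by omega)
    | exact q5 (by omega) (by omega)
    | exact q6 (by omega) (by omega)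
    | exact (q1 (by omega) (by omega)).symm
    | exact (q2 (by omega) (by omega)).symm
    | exact (q3 (by omega) (by omega)).symm
    | exact (q4 (by omega) (by omega)).symm
    | exact (q5 (by omega) (by omega)).symm
    | exact (q6 (by omega) (by omega)).symm

lemma gcol_palette {s t : ℕ} {H V : ℕ → ℕ → ℕ} (v : Fin s × Fin t) :
    palette (pathGraph s □ pathGraph t) (gcol s t H V) v = gpal s t H V v.1 v.2 := by
  obtain ⟨⟨i, hi⟩, ⟨j, hj⟩⟩ := v
  rw [palette_eq_image]
  ext c
  constructor
  · rintro ⟨⟨⟨k, hk⟩, ⟨l, hl⟩⟩, hx, rfl⟩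
    have a1 := gcol_adj (H := H) (V := V) hi hj hk hl hx
    rcases a1 with ⟨b1, b2, b3⟩ | ⟨b0, b1, b2, b3⟩ | ⟨b1, b2, b3⟩ | ⟨b0, b1, b2, b3⟩
    · exact Or.inl ⟨by simp only; omega, b3⟩
    · exact Or.inr (Or.inl ⟨b1, b3⟩)
    · exact Or.inr (Or.inr (Or.inl ⟨by simp only; omega, b3⟩))
    · exact Or.inr (Or.inr (Or.inr ⟨b0, b3⟩))
  · rintro (⟨h, rfl⟩ | ⟨h, rfl⟩ | ⟨h, rfl⟩ | ⟨h, rfl⟩) <;> simp only at h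
    · refine ⟨(⟨i, hi⟩, ⟨j + 1, h⟩), ?_, ?_⟩
      · simp [boxProd_adj, pathGraph_adj]
      · simp [gcol]
    · refine ⟨(⟨i, hi⟩, ⟨j - 1, by omega⟩), ?_, ?_⟩
      · simp [boxProd_adj, pathGraph_adj]; omega
      · simp [gcol]
    · refine ⟨(⟨i + 1, h⟩, ⟨j, hj⟩), ?_, ?_⟩
      · simp [boxProd_adj, pathGraph_adj]
      · simp [gcol]
    · refine ⟨(⟨i - 1, by omega⟩, ⟨j, hj⟩), ?_, ?_⟩
      · simp [boxProd_adj, pathGraph_adj]; omega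
      · have : i ≠ i - 1 := by omega
        simp [gcol, this]

lemma numPalettes_le_of_subset {s t : ℕ} {f : Sym2 (Fin s × Fin t) → ℕ} (F : Finset (Set ℕ))
    (h : ∀ v, palette (pathGraph s □ pathGraph t) f v ∈ F) :
    numPalettes (pathGraph s □ pathGraph t) f ≤ F.card := by
  rw [numPalettes, ← Set.ncard_coe_finset]
  refine Set.ncard_le_ncard ?_ (Finset.finite_toSet F)
  rintro _ ⟨v, rfl⟩
  exact h v

/-- Horizontal colors for `t` even. -/
def evH (s i j : ℕ) : ℕ :=
  if i = 0 then (if j % 2 = 0 then 1 else 2)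
  else if i + 1 = s then (if j % 2 = 0 then (if s % 2 = 0 then 1 else 0) else 2)
  else (if j % 2 = 0 then 2 else 3)

/-- Vertical colors for `t` even. -/
def evV (i _j : ℕ) : ℕ := i % 2

lemma ev_prop (s t i j : ℕ) : gprop s t (evH s) evV i j := by
  unfold gprop evH evV
  refine ⟨?_, ?_, ?_, ?_, ?_, ?_⟩ <;> intros <;> (try dsimp only) <;> (try split_ifs) <;> omega

lemma ev_pal (s t i j : ℕ) (hs : 2 ≤ s) (ht : 2 ≤ t) (et : t % 2 = 0) (hi : i < s) (hj : j < t) :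
    gpal s t (evH s) evV i j = {c | c < pdeg s i + pdeg t j} := by
  ext c
  simp only [gpal, evH, evV, pdeg, Set.mem_ofPred_eq]
  split_ifs <;> omega

lemma ev_prop' (s t i j : ℕ) : gprop s t (fun i j => evV j i) (fun i j => evH t j i) i j := by
  unfold gprop evH evV
  refine ⟨?_, ?_, ?_, ?_, ?_, ?_⟩ <;> intros <;> (try dsimp only) <;> (try split_ifs) <;> omega

lemma ev_pal' (s t i j : ℕ) (hs : 2 ≤ s) (ht : 2 ≤ t) (et : s % 2 = 0) (hi : i < s) (hj : j < t) :
    gpal s t (fun i j => evV j i) (fun i j => evH t j i) i j =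
      {c | c < pdeg s i + pdeg t j} := by
  ext c
  simp only [gpal, evH, evV, pdeg, Set.mem_ofPred_eq]
  split_ifs <;> omega

lemma even_coloring (s t : ℕ) (hs : 2 ≤ s) (ht : 2 ≤ t) (h : Even (s * t)) :
    ∃ f, IsProperEdgeColoring (pathGraph s □ pathGraph t) f ∧
      ∀ v, palette (pathGraph s □ pathGraph t) f v = {c | c < pdeg s v.1 + pdeg t v.2} := by
  rcases Nat.even_mul.1 h with h | h
  · refine ⟨_, gcol_proper fun i j _ _ => ev_prop' s t i j, fun v => ?_⟩
    rw [gcol_palette, ev_pal' s t _ _ hs ht (Nat.even_iff.1 h) v.1.2 v.2.2]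
  · refine ⟨_, gcol_proper fun i j _ _ => ev_prop s t i j, fun v => ?_⟩
    rw [gcol_palette, ev_pal s t _ _ hs ht (Nat.even_iff.1 h) v.1.2 v.2.2]

/-- Horizontal colors for `s`, `t` odd. -/
def odH (i j : ℕ) : ℕ :=
  if i = 0 then (if j % 2 = 0 then 0 else 2)
  else if i = 1 then (if j = 0 then 2 else if j % 2 = 0 then 0 else 1)
  else if i = 2 then (if j = 0 then 2 else if j % 2 = 0 then 0 else 3)
  else (if j = 0 then 3 else if j % 2 = 0 then 0 else 2)

/-- Vertical colors for `s`, `t` odd. -/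
def odV (i j : ℕ) : ℕ :=
  if j = 0 then (if i % 2 = 0 then 1 else if i = 1 then 3 else 2)
  else if i = 0 then 3
  else if i % 2 = 0 then 1
  else if j = 1 then 0
  else if i = 1 then 2 else 3

lemma od_prop (s t i j : ℕ) : gprop s t odH odV i j := by
  unfold gprop odH odV
  refine ⟨?_, ?_, ?_, ?_, ?_, ?_⟩ <;> intros <;> (try dsimp only) <;> (try split_ifs) <;> omega

/-- If the colors at `(i, j)` lie in an allowed set, and this set is no larger than the degree,
then the palette is the allowed set. -/
lemma od_mem (s t i j : ℕ) (Q : ℕ → Prop)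
    (h1 : j + 1 < t → Q (odH i j)) (h2 : 0 < j → Q (odH i (j - 1)))
    (h3 : i + 1 < s → Q (odV i j)) (h4 : 0 < i → Q (odV (i - 1) j))
    (hQ : ∀ a b c d e : ℕ, Q e → (j + 1 < t → Q a) → (0 < j → Q b) → (i + 1 < s → Q c) →
      (0 < i → Q d) → (j + 1 < t → 0 < j → a ≠ b) → (j + 1 < t → i + 1 < s → a ≠ c) →
      (j + 1 < t → 0 < i → a ≠ d) → (0 < j → i + 1 < s → b ≠ c) → (0 < j → 0 < i → b ≠ d) →
      (i + 1 < s → 0 < i → c ≠ d) →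
      (j + 1 < t ∧ e = a) ∨ (0 < j ∧ e = b) ∨ (i + 1 < s ∧ e = c) ∨ (0 < i ∧ e = d)) :
    gpal s t odH odV i j = {c | Q c} := by
  obtain ⟨q1, q2, q3, q4, q5, q6⟩ := od_prop s t i j
  ext e
  simp only [gpal, Set.mem_ofPred_eq]
  constructor
  · rintro (⟨h, rfl⟩ | ⟨h, rfl⟩ | ⟨h, rfl⟩ | ⟨h, rfl⟩)
    exacts [h1 h, h2 h, h3 h, h4 h]
  · intro he
    exact hQ _ _ _ _ e he h1 h2 h3 h4 q1 q2 q3 q4 q5 q6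

lemma od_int (s t i j : ℕ) (hs : 3 ≤ s) (ht : 3 ≤ t) (os : s % 2 = 1) (ot : t % 2 = 1)
    (hi : i < s) (hj : j < t) (i0 : 0 < i) (i1 : i + 1 < s) (j0 : 0 < j) (j1 : j + 1 < t) :
    gpal s t odH odV i j = {c | c < 4} := by
  apply od_mem
  · intro _; unfold odH; split_ifs <;> omega
  · intro _; unfold odH; split_ifs <;> omega
  · intro _; unfold odV; split_ifs <;> omega
  · intro _; unfold odV; split_ifs <;> omega
  · intro a b c d e he ha hb hc hd q1 q2 q3 q4 q5 q6
    have x1 : j + 1 < t := by omega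
    have x2 : 0 < j := by omega
    have x3 : i + 1 < s := by omega
    have x4 : 0 < i := by omega
    rcases fill4 a b c d e (ha x1) (hb x2) (hc x3) (hd x4) he
      (q1 x1 x2) (q2 x1 x3) (q3 x1 x4) (q4 x2 x3) (q5 x2 x4) (q6 x3 x4)
      with rfl | rfl | rfl | rfl <;> simp [x1, x2, x3, x4]

lemma od_top (s t i j : ℕ) (hs : 3 ≤ s) (ht : 3 ≤ t) (os : s % 2 = 1) (ot : t % 2 = 1)
    (hi : i < s) (hj : j < t) (i0 : i = 0) (j0 : 0 < j) (j1 : j + 1 < t) :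
    gpal s t odH odV i j = {c | c = 0 ∨ c = 2 ∨ c = 3} := by
  apply od_mem
  · intro _; unfold odH; split_ifs <;> omega
  · intro _; unfold odH; split_ifs <;> omega
  · intro _; unfold odV; split_ifs <;> omega
  · intro _; unfold odV; split_ifs <;> omega
  · intro a b c d e he ha hb hc hd q1 q2 q3 q4 q5 q6
    have x1 : j + 1 < t := by omega
    have x2 : 0 < j := by omega
    have x3 : i + 1 < s := by omega
    rcases fill3 0 2 3 a b c e (ha x1) (hb x2) (hc x3) he
      (q1 x1 x2) (q2 x1 x3) (q4 x2 x3)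
      with rfl | rfl | rfl <;> simp [x1, x2, x3]

lemma od_bot (s t i j : ℕ) (hs : 3 ≤ s) (ht : 3 ≤ t) (os : s % 2 = 1) (ot : t % 2 = 1)
    (hi : i < s) (hj : j < t) (i0 : i + 1 = s) (j0 : 0 < j) (j1 : j + 1 < t) :
    gpal s t odH odV i j = {c | c = 0 ∨ c = 2 ∨ c = 3} := by
  apply od_mem
  · intro _; unfold odH; split_ifs <;> omega
  · intro _; unfold odH; split_ifs <;> omega
  · intro _; unfold odV; split_ifs <;> omega
  · intro _; unfold odV; split_ifs <;> omega
  · intro a b c d e he ha hb hc hd q1 q2 q3 q4 q5 q6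
    have x1 : j + 1 < t := by omega
    have x2 : 0 < j := by omega
    have x4 : 0 < i := by omega
    rcases fill3 0 2 3 a b d e (ha x1) (hb x2) (hd x4) he
      (q1 x1 x2) (q3 x1 x4) (q5 x2 x4)
      with rfl | rfl | rfl <;> simp [x1, x2, x4]

lemma od_left (s t i j : ℕ) (hs : 3 ≤ s) (ht : 3 ≤ t) (os : s % 2 = 1) (ot : t % 2 = 1)
    (hi : i < s) (hj : j < t) (j0 : j = 0) (i0 : 0 < i) (i1 : i + 1 < s) :
    gpal s t odH odV i j = {c | c = 1 ∨ c = 2 ∨ c = 3} := by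
  apply od_mem
  · intro _; unfold odH; split_ifs <;> omega
  · intro _; unfold odH; split_ifs <;> omega
  · intro _; unfold odV; split_ifs <;> omega
  · intro _; unfold odV; split_ifs <;> omega
  · intro a b c d e he ha hb hc hd q1 q2 q3 q4 q5 q6
    have x1 : j + 1 < t := by omega
    have x3 : i + 1 < s := by omega
    have x4 : 0 < i := by omega
    rcases fill3 1 2 3 a c d e (ha x1) (hc x3) (hd x4) he
      (q2 x1 x3) (q3 x1 x4) (q6 x3 x4)
      with rfl | rfl | rfl <;> simp [x1, x3, x4]

lemma od_right (s t i j : ℕ) (hs : 3 ≤ s) (ht : 3 ≤ t) (os : s % 2 = 1) (ot : t % 2 = 1)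
    (hi : i < s) (hj : j < t) (j0 : j + 1 = t) (i0 : 0 < i) (i1 : i + 1 < s) :
    gpal s t odH odV i j = {c | c = 1 ∨ c = 2 ∨ c = 3} := by
  apply od_mem
  · intro _; unfold odH; split_ifs <;> omega
  · intro _; unfold odH; split_ifs <;> omega
  · intro _; unfold odV; split_ifs <;> omega
  · intro _; unfold odV; split_ifs <;> omega
  · intro a b c d e he ha hb hc hd q1 q2 q3 q4 q5 q6
    have x2 : 0 < j := by omega
    have x3 : i + 1 < s := by omega
    have x4 : 0 < i := by omega
    rcases fill3 1 2 3 b c d e (hb x2) (hc x3) (hd x4) he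
      (q4 x2 x3) (q5 x2 x4) (q6 x3 x4)
      with rfl | rfl | rfl <;> simp [x2, x3, x4]

lemma od_tl (s t i j : ℕ) (hs : 3 ≤ s) (ht : 3 ≤ t) (os : s % 2 = 1) (ot : t % 2 = 1)
    (hi : i < s) (hj : j < t) (i0 : i = 0) (j0 : j = 0) :
    gpal s t odH odV i j = {c | c = 0 ∨ c = 1} := by
  apply od_mem
  · intro _; unfold odH; split_ifs <;> omega
  · intro _; unfold odH; split_ifs <;> omega
  · intro _; unfold odV; split_ifs <;> omega
  · intro _; unfold odV; split_ifs <;> omega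
  · intro a b c d e he ha hb hc hd q1 q2 q3 q4 q5 q6
    have x1 : j + 1 < t := by omega
    have x3 : i + 1 < s := by omega
    rcases fill2 0 1 a c e (ha x1) (hc x3) he
      (q2 x1 x3)
      with rfl | rfl <;> simp [x1, x3]

lemma od_tr (s t i j : ℕ) (hs : 3 ≤ s) (ht : 3 ≤ t) (os : s % 2 = 1) (ot : t % 2 = 1)
    (hi : i < s) (hj : j < t) (i0 : i = 0) (j0 : j + 1 = t) :
    gpal s t odH odV i j = {c | c = 2 ∨ c = 3} := by
  apply od_mem
  · intro _; unfold odH; split_ifs <;> omega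
  · intro _; unfold odH; split_ifs <;> omega
  · intro _; unfold odV; split_ifs <;> omega
  · intro _; unfold odV; split_ifs <;> omega
  · intro a b c d e he ha hb hc hd q1 q2 q3 q4 q5 q6
    have x2 : 0 < j := by omega
    have x3 : i + 1 < s := by omega
    rcases fill2 2 3 b c e (hb x2) (hc x3) he
      (q4 x2 x3)
      with rfl | rfl <;> simp [x2, x3]

lemma od_bl (s t i j : ℕ) (hs : 3 ≤ s) (ht : 3 ≤ t) (os : s % 2 = 1) (ot : t % 2 = 1)
    (hi : i < s) (hj : j < t) (i0 : i + 1 = s) (j0 : j = 0) :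
    gpal s t odH odV i j = {c | c = 2 ∨ c = 3} := by
  apply od_mem
  · intro _; unfold odH; split_ifs <;> omega
  · intro _; unfold odH; split_ifs <;> omega
  · intro _; unfold odV; split_ifs <;> omega
  · intro _; unfold odV; split_ifs <;> omega
  · intro a b c d e he ha hb hc hd q1 q2 q3 q4 q5 q6
    have x1 : j + 1 < t := by omega
    have x4 : 0 < i := by omega
    rcases fill2 2 3 a d e (ha x1) (hd x4) he
      (q3 x1 x4)
      with rfl | rfl <;> simp [x1, x4]

lemma od_br (s t i j : ℕ) (hs : 3 ≤ s) (ht : 3 ≤ t) (os : s % 2 = 1) (ot : t % 2 = 1)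
    (hi : i < s) (hj : j < t) (i0 : i + 1 = s) (j0 : j + 1 = t) :
    gpal s t odH odV i j = {c | c = 2 ∨ c = 3} := by
  apply od_mem
  · intro _; unfold odH; split_ifs <;> omega
  · intro _; unfold odH; split_ifs <;> omega
  · intro _; unfold odV; split_ifs <;> omega
  · intro _; unfold odV; split_ifs <;> omega
  · intro a b c d e he ha hb hc hd q1 q2 q3 q4 q5 q6
    have x2 : 0 < j := by omega
    have x4 : 0 < i := by omega
    rcases fill2 2 3 b d e (hb x2) (hd x4) he
      (q5 x2 x4)
      with rfl | rfl <;> simp [x2, x4]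

lemma od_pal (s t i j : ℕ) (hs : 3 ≤ s) (ht : 3 ≤ t) (os : s % 2 = 1) (ot : t % 2 = 1)
    (hi : i < s) (hj : j < t) :
    gpal s t odH odV i j = {c | c < 4} ∨ gpal s t odH odV i j = {c | c = 0 ∨ c = 2 ∨ c = 3} ∨
    gpal s t odH odV i j = {c | c = 1 ∨ c = 2 ∨ c = 3} ∨
    gpal s t odH odV i j = {c | c = 0 ∨ c = 1} ∨
    gpal s t odH odV i j = {c | c = 2 ∨ c = 3} := by
  rcases (show i = 0 ∨ i + 1 = s ∨ (0 < i ∧ i + 1 < s) by omega) with ei | ei | ⟨i0, i1⟩ <;>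
  rcases (show j = 0 ∨ j + 1 = t ∨ (0 < j ∧ j + 1 < t) by omega) with ej | ej | ⟨j0, j1⟩
  · simp [od_tl s t i j hs ht os ot hi hj ei ej]
  · simp [od_tr s t i j hs ht os ot hi hj ei ej]
  · simp [od_top s t i j hs ht os ot hi hj ei j0 j1]
  · simp [od_bl s t i j hs ht os ot hi hj ei ej]
  · simp [od_br s t i j hs ht os ot hi hj ei ej]
  · simp [od_bot s t i j hs ht os ot hi hj ei j0 j1]
  · simp [od_left s t i j hs ht os ot hi hj ej i0 i1]
  · simp [od_right s t i j hs ht os ot hi hj ej i0 i1]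
  · simp [od_int s t i j hs ht os ot hi hj i0 i1 j0 j1]

lemma upper_odd (s t : ℕ) (hs : 3 ≤ s) (ht : 3 ≤ t) (os : Odd s) (ot : Odd t) :
    ∃ f, IsProperEdgeColoring (pathGraph s □ pathGraph t) f ∧
      numPalettes (pathGraph s □ pathGraph t) f ≤ 5 := by
  classical
  refine ⟨_, gcol_proper fun i j _ _ => od_prop s t i j, ?_⟩
  refine (numPalettes_le_of_subset ({{c | c < 4}, {c | c = 0 ∨ c = 2 ∨ c = 3},
    {c | c = 1 ∨ c = 2 ∨ c = 3}, {c | c = 0 ∨ c = 1}, {c | c = 2 ∨ c = 3}} :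
      Finset (Set ℕ)) fun v => ?_).trans Finset.card_le_five
  rw [gcol_palette]
  simp only [Finset.mem_insert, Finset.mem_singleton]
  exact od_pal s t _ _ hs ht (Nat.odd_iff.1 os) (Nat.odd_iff.1 ot) v.1.2 v.2.2

lemma paletteIndex_eq {V : Type*} {G : SimpleGraph V} {n : ℕ}
    (hl : ∀ f, IsProperEdgeColoring G f → n ≤ numPalettes G f)
    (hu : ∃ f, IsProperEdgeColoring G f ∧ numPalettes G f ≤ n) : paletteIndex G = n := by
  obtain ⟨f, hf, hn⟩ := hu
  have h1 : paletteIndex G ≤ numPalettes G f := Nat.sInf_le ⟨f, hf, rfl⟩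
  refine le_antisymm (h1.trans hn) ?_
  refine le_csInf ⟨_, f, hf, rfl⟩ ?_
  rintro _ ⟨g, hg, rfl⟩
  exact hl g hg

/-- The number of palettes is at least the number of degrees. -/
lemma lower_deg {s t : ℕ} (hs : 2 ≤ s) (ht : 2 ≤ t) {f : Sym2 (Fin s × Fin t) → ℕ}
    (hf : IsProperEdgeColoring (pathGraph s □ pathGraph t) f) (D : Finset ℕ)
    (hD : ∀ d ∈ D, ∃ v : Fin s × Fin t, pdeg s v.1 + pdeg t v.2 = d) :
    D.card ≤ numPalettes (pathGraph s □ pathGraph t) f := by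
  rw [numPalettes, ← Set.ncard_coe_finset]
  refine (Set.ncard_le_ncard ?_ ((Set.finite_range _).image Set.ncard)).trans
    (Set.ncard_image_le (Set.finite_range _))
  intro d hd
  obtain ⟨v, hv⟩ := hD d hd
  exact ⟨_, ⟨v, rfl⟩, (palette_ncard hs ht hf v).trans hv⟩

lemma index_even (s t : ℕ) (hs : 2 ≤ s) (ht : 2 ≤ t) (h : Even (s * t)) (D : Finset ℕ)
    (hD : ∀ d ∈ D, ∃ v : Fin s × Fin t, pdeg s v.1 + pdeg t v.2 = d)
    (hD' : ∀ v : Fin s × Fin t, pdeg s v.1 + pdeg t v.2 ∈ D) :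
    paletteIndex (pathGraph s □ pathGraph t) = D.card := by
  classical
  refine paletteIndex_eq (fun f hf => lower_deg hs ht hf D hD) ?_
  obtain ⟨f, hf, hp⟩ := even_coloring s t hs ht h
  refine ⟨f, hf, (numPalettes_le_of_subset (D.image fun d => {c | c < d}) fun v => ?_).trans
    Finset.card_image_le⟩
  rw [hp]
  exact Finset.mem_image_of_mem (fun d => {c | c < d}) (hD' v)

/-- palette index of `P_s □ P_t` for `s, t ≥ 2`. -/
theorem paletteIndex_pathGraph_boxProd_pathGraph (s t : ℕ) (hs : 2 ≤ s) (ht : 2 ≤ t) :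
    (s = 2 ∧ t = 2 → paletteIndex (pathGraph s □ pathGraph t) = 1) ∧
    (min s t = 2 ∧ 3 ≤ max s t → paletteIndex (pathGraph s □ pathGraph t) = 2) ∧
    (3 ≤ s ∧ 3 ≤ t ∧ Even (s * t) → paletteIndex (pathGraph s □ pathGraph t) = 3) ∧
    (3 ≤ s ∧ 3 ≤ t ∧ Odd (s * t) → paletteIndex (pathGraph s □ pathGraph t) = 5) := by

  refine ⟨?_, ?_, ?_, ?_⟩
  · rintro ⟨rfl, rfl⟩
    refine index_even 2 2 le_rfl le_rfl (by decide) {2} ?_ ?_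
    · intro d hd
      rw [Finset.mem_singleton] at hd
      exact ⟨(0, 0), by simp [pdeg, hd]⟩
    · decide
  · rintro ⟨h1, h2⟩
    refine index_even s t hs ht ?_ {2, 3} ?_ ?_
    · rw [Nat.even_mul]
      rcases min_choice s t with h | h
      · left; rw [← h, h1]; decide
      · right; rw [← h, h1]; decide
    · intro d hd
      simp only [Finset.mem_insert, Finset.mem_singleton] at hd
      rcases hd with rfl | rfl
      · exact ⟨(⟨0, by omega⟩, ⟨0, by omega⟩), by simp [pdeg]⟩
      · by_cases h : s = 2
        · refine ⟨(⟨0, by omega⟩, ⟨1, by omega⟩), ?_⟩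
          show pdeg s 0 + pdeg t 1 = _
          rw [pdeg_zero, pdeg_one t (by omega)]
        · refine ⟨(⟨1, by omega⟩, ⟨0, by omega⟩), ?_⟩
          show pdeg s 1 + pdeg t 0 = _
          rw [pdeg_one s (by omega), pdeg_zero]
    · rintro ⟨⟨i, hi⟩, ⟨j, hj⟩⟩
      simp only [Finset.mem_insert, Finset.mem_singleton, pdeg]
      split_ifs <;> omega
  · rintro ⟨h1, h2, he⟩
    refine index_even s t hs ht he {2, 3, 4} ?_ ?_
    · intro d hd
      simp only [Finset.mem_insert, Finset.mem_singleton] at hd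
      rcases hd with rfl | rfl | rfl
      · exact ⟨(⟨0, by omega⟩, ⟨0, by omega⟩), by simp [pdeg]⟩
      · refine ⟨(⟨0, by omega⟩, ⟨1, by omega⟩), ?_⟩
        show pdeg s 0 + pdeg t 1 = _
        rw [pdeg_zero, pdeg_one t (by omega)]
      · refine ⟨(⟨1, by omega⟩, ⟨1, by omega⟩), ?_⟩
        show pdeg s 1 + pdeg t 1 = _
        rw [pdeg_one s (by omega), pdeg_one t (by omega)]
    · rintro ⟨⟨i, hi⟩, ⟨j, hj⟩⟩
      simp only [Finset.mem_insert, Finset.mem_singleton, pdeg]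
      split_ifs <;> omega
  · rintro ⟨h1, h2, ho⟩
    obtain ⟨os, ot⟩ := Nat.odd_mul.1 ho
    exact paletteIndex_eq (fun f hf => lower_odd s t h1 h2 os ot hf) (upper_odd s t h1 h2 os ot)
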